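/- Let n be even, let s, t be pseudo-secondary structures on n positions with dg(s) ≥ dg(t), and let s', t' be pseudo-secondary structures on n+1 positions with s ≺ s', t ≺ t'. If |s'| = |s| + 1 and |t'| = |t| + 1, then dg(s') ≥ dg(t'). -/

import Mathlib

/-- A pseudo-secondary structure on `n` positions: a partial matching on
`{1,…,n}`, i.e. a set of pairs `(i,j)` with `1 ≤ i < j ≤ n` in which no
position occurs in more than one pair (crossings allowed, θ = 0). -/
def IsPseudo (n : ℕ) (s : Finset (ℕ × ℕ)) : Prop :=
  (∀ p ∈ s, 1 ≤ p.1 ∧ p.1 < p.2 ∧ p.2 ≤ n) ∧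
  (∀ p ∈ s, ∀ q ∈ s, p ≠ q →
    p.1 ≠ q.1 ∧ p.1 ≠ q.2 ∧ p.2 ≠ q.1 ∧ p.2 ≠ q.2)

/-- `t` is obtained from `s` by adding or removing exactly one pair. -/
def Neighbor (s t : Finset (ℕ × ℕ)) : Prop :=
  (∃ p, p ∉ s ∧ t = insert p s) ∨ (∃ p, p ∈ s ∧ t = s.erase p)

/-- The degree `dg` of a pseudo-secondary structure `s` on `n` positions:
the number of pseudo-secondary structures on `n` positions obtainable from
`s` by adding or removing exactly one pair. -/
noncomputable def dg (n : ℕ) (s : Finset (ℕ × ℕ)) : ℕ :=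
  Set.ncard {t : Finset (ℕ × ℕ) | IsPseudo n t ∧ Neighbor s t}

/-- `s'` (on `n+1` positions) extends `s` (on `n` positions), written `s ≺ s'`:
either `s' = s` (position `n+1` unpaired), or `s' = s ∪ {(k, n+1)}` for some
position `k ∈ {1,…,n}` unpaired in `s`. -/
def ExtendsTo (n : ℕ) (s s' : Finset (ℕ × ℕ)) : Prop :=
  s' = s ∨ ∃ k, 1 ≤ k ∧ k ≤ n ∧ (∀ p ∈ s, p.1 ≠ k ∧ p.2 ≠ k) ∧
    s' = insert (k, n + 1) s

def posSet (s : Finset (ℕ × ℕ)) : Finset ℕ := s.biUnion fun p => {p.1, p.2}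

def freeSet (n : ℕ) (s : Finset (ℕ × ℕ)) : Finset ℕ := Finset.Icc 1 n \ posSet s

def pairSet (U : Finset ℕ) : Finset (ℕ × ℕ) := U.offDiag.filter fun p => p.1 < p.2

lemma pairSet_card (U : Finset ℕ) : 2 * (pairSet U).card + U.card = U.card * U.card := by
  have h1 := Finset.card_filter_add_card_filter_not (s := U.offDiag) (fun p => p.1 < p.2)
  have h2 : (U.offDiag.filter fun p => ¬ p.1 < p.2).card = (pairSet U).card := by
    apply Finset.card_bij (fun p _ => p.swap)
    · intro p hp
      simp only [pairSet, Finset.mem_filter, Finset.mem_offDiag, Prod.fst_swap, Prod.snd_swap] at *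
      grind
    · intro p _ q _ h
      exact Prod.swap_injective h
    · intro p hp
      refine ⟨p.swap, ?_, by simp⟩
      simp only [pairSet, Finset.mem_filter, Finset.mem_offDiag, Prod.fst_swap, Prod.snd_swap] at *
      grind
  rw [h2, Finset.offDiag_card] at h1
  have h3 : U.card ≤ U.card * U.card := Nat.le_mul_self _
  change (pairSet U).card + _ = _ at h1
  omega

lemma posSet_card {n : ℕ} {s : Finset (ℕ × ℕ)} (hs : IsPseudo n s) :
    (posSet s).card = 2 * s.card := by
  unfold posSet
  rw [Finset.card_biUnion]
  · rw [Finset.sum_congr rfl (g := fun _ => 2)]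
    · simp [mul_comm]
    · intro p hp
      have := hs.1 p hp
      exact Finset.card_pair (by omega)
  · intro p hp q hq hpq
    have := hs.2 p hp q hq hpq
    simp only [Function.onFun, Finset.disjoint_left, Finset.mem_insert, Finset.mem_singleton]
    grind

lemma posSet_sub {n : ℕ} {s : Finset (ℕ × ℕ)} (hs : IsPseudo n s) :
    posSet s ⊆ Finset.Icc 1 n := by
  intro x hx
  simp only [posSet, Finset.mem_biUnion, Finset.mem_insert, Finset.mem_singleton] at hx
  obtain ⟨p, hp, h⟩ := hx
  have := hs.1 p hp
  simp only [Finset.mem_Icc]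
  omega

lemma free_card {n : ℕ} {s : Finset (ℕ × ℕ)} (hs : IsPseudo n s) :
    (freeSet n s).card + 2 * s.card = n := by
  have h := Finset.card_sdiff_add_card_eq_card (posSet_sub hs)
  rw [posSet_card hs] at h
  simpa [freeSet] using h

lemma mem_free {n : ℕ} {s : Finset (ℕ × ℕ)} {x : ℕ} :
    x ∈ freeSet n s ↔ (1 ≤ x ∧ x ≤ n) ∧ ∀ p ∈ s, x ≠ p.1 ∧ x ≠ p.2 := by
  simp only [freeSet, posSet, Finset.mem_sdiff, Finset.mem_Icc, Finset.mem_biUnion,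
    Finset.mem_insert, Finset.mem_singleton, not_exists, not_and, not_or]

lemma nbr_eq {n : ℕ} {s : Finset (ℕ × ℕ)} (hs : IsPseudo n s) :
    {t : Finset (ℕ × ℕ) | IsPseudo n t ∧ Neighbor s t} =
      ↑((pairSet (freeSet n s)).image (fun p => insert p s) ∪ s.image (fun p => s.erase p)) := by
  ext t
  simp only [Set.mem_ofPred_eq, Finset.coe_union, Finset.coe_image, Set.mem_union, Set.mem_image,
    Finset.mem_coe, Neighbor, pairSet, Finset.mem_filter, Finset.mem_offDiag, mem_free]
  constructor
  · rintro ⟨ht, ⟨p, hp, rfl⟩ | ⟨p, hp, rfl⟩⟩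
    · left
      refine ⟨p, ?_, rfl⟩
      have h1 := ht.1 p (Finset.mem_insert_self _ _)
      have h2 : ∀ q ∈ s, p.1 ≠ q.1 ∧ p.1 ≠ q.2 ∧ p.2 ≠ q.1 ∧ p.2 ≠ q.2 := fun q hq =>
        ht.2 p (Finset.mem_insert_self _ _) q (Finset.mem_insert_of_mem hq)
          (by rintro rfl; exact hp hq)
      refine ⟨⟨⟨⟨h1.1, by omega⟩, fun q hq => ?_⟩, ⟨⟨by omega, h1.2.2⟩, fun q hq => ?_⟩,
        by omega⟩, h1.2.1⟩
      · exact ⟨(h2 q hq).1, (h2 q hq).2.1⟩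
      · exact (h2 q hq).2.2
    · right; exact ⟨p, hp, rfl⟩
  · rintro (⟨p, ⟨⟨⟨h1, h2⟩, ⟨h3, h4⟩, h5⟩, h6⟩, rfl⟩ | ⟨p, hp, rfl⟩)
    · refine ⟨⟨?_, ?_⟩, Or.inl ⟨p, fun hp => (h2 p hp).1 rfl, rfl⟩⟩
      · intro q hq
        rcases Finset.mem_insert.1 hq with rfl | hq
        · omega
        · exact hs.1 q hq
      · intro q hq r hr hqr
        rcases Finset.mem_insert.1 hq with hq1 | hq1 <;>
          rcases Finset.mem_insert.1 hr with hr1 | hr1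
        · exact absurd (hq1.trans hr1.symm) hqr
        · subst hq1; have := h2 r hr1; have := h4 r hr1; omega
        · subst hr1; have := h2 q hq1; have := h4 q hq1; omega
        · exact hs.2 q hq1 r hr1 hqr
    · refine ⟨⟨fun q hq => hs.1 q (Finset.mem_of_mem_erase hq), fun q hq r hr =>
        hs.2 q (Finset.mem_of_mem_erase hq) r (Finset.mem_of_mem_erase hr)⟩, Or.inr ⟨p, hp, rfl⟩⟩

lemma dg_eq {n : ℕ} {s : Finset (ℕ × ℕ)} (hs : IsPseudo n s) :
    dg n s = (pairSet (freeSet n s)).card + s.card := by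
  have hnot : ∀ p ∈ pairSet (freeSet n s), p ∉ s := by
    intro p hp hps
    simp only [pairSet, Finset.mem_filter, Finset.mem_offDiag, mem_free] at hp
    exact (hp.1.1.2 p hps).1 rfl
  unfold dg
  rw [nbr_eq hs, Set.ncard_coe_finset, Finset.card_union_of_disjoint, Finset.card_image_of_injOn,
    Finset.card_image_of_injOn]
  · intro p hp q hq h
    exact (Finset.erase_inj s hp).1 h
  · intro p hp q hq h
    exact (Finset.insert_inj (hnot p hp)).1 h
  · rw [Finset.disjoint_left]
    intro t h1 h2
    obtain ⟨p, hp, rfl⟩ := Finset.mem_image.1 h1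
    obtain ⟨q, hq, h⟩ := Finset.mem_image.1 h2
    have : p ∈ s.erase q := by simp only [h]; exact Finset.mem_insert_self _ _
    exact hnot p hp (Finset.mem_of_mem_erase this)

theorem stmt_14 (n : ℕ) (hn : Even n) (s t s' t' : Finset (ℕ × ℕ))
    (hs : IsPseudo n s) (ht : IsPseudo n t) (hst : dg n s ≥ dg n t)
    (hs' : IsPseudo (n + 1) s') (ht' : IsPseudo (n + 1) t')
    (hes : ExtendsTo n s s') (het : ExtendsTo n t t')
    (hcs : s'.card = s.card + 1) (hct : t'.card = t.card + 1) :
    dg (n + 1) s' ≥ dg (n + 1) t' := by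
  rw [dg_eq hs, dg_eq ht] at hst
  rw [dg_eq hs', dg_eq ht']
  have a1 := pairSet_card (freeSet n s)
  have a2 := pairSet_card (freeSet n t)
  have a3 := pairSet_card (freeSet (n+1) s')
  have a4 := pairSet_card (freeSet (n+1) t')
  have b1 := free_card hs
  have b2 := free_card ht
  have b3 := free_card hs'
  have b4 := free_card ht'
  obtain ⟨m, rfl⟩ := hn
  generalize (pairSet (freeSet _ s)).card = A1 at *
  generalize (pairSet (freeSet _ t)).card = A2 at *
  generalize (pairSet (freeSet _ s')).card = A3 at *
  generalize (pairSet (freeSet _ t')).card = A4 at *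
  generalize (freeSet _ s).card = u1 at *
  generalize (freeSet _ t).card = u2 at *
  generalize (freeSet _ s').card = u3 at *
  generalize (freeSet _ t').card = u4 at *
  rw [hcs] at *
  rw [hct] at *
  generalize s.card = c at *
  generalize t.card = d at *
  obtain ⟨x, rfl⟩ : ∃ x, u3 = 2 * x + 1 := ⟨u3 / 2, by omega⟩
  obtain ⟨y, rfl⟩ : ∃ y, u4 = 2 * y + 1 := ⟨u4 / 2, by omega⟩
  obtain rfl : u1 = 2 * x + 2 := by omega
  obtain rfl : u2 = 2 * y + 2 := by omega
  have e1 : A1 = 2 * (x * x) + 3 * x + 1 := by linarith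
  have e2 : A2 = 2 * (y * y) + 3 * y + 1 := by linarith
  have e3 : A3 = 2 * (x * x) + x := by linarith
  have e4 : A4 = 2 * (y * y) + y := by linarith
  clear a1 a2 a3 a4
  have hxy : y ≤ x := by
    by_contra hlt
    push Not at hlt
    have := Nat.mul_le_mul hlt.le hlt.le
    omega
  have h1 := Nat.mul_le_mul hxy hxy
  omega
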